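/- Let ω ∈ Ω₊ satisfy liminf_{i→∞} (1/i) Σ_{y=−i}^{0} (2ω(y,1) − 1) > 0. Then for all integers x and k with k ≥ x, the expected total drift consumed before the walk first reaches k equals E_{x,ω}[D_{T_k}] = k − x. -/

import Mathlib

open MeasureTheory Filter Set Topology ProbabilityTheory
open scoped ENNReal ENat

noncomputable section

/-- A cookie environment: `ω z i` is the strength of the `(i+1)`-st cookie at site `z`
(cookies at each site are indexed by `i = 0, 1, 2, …`). -/
abbrev CEnv : Type := ℤ → ℕ → ℝ

/-- `ω` belongs to `Ω₊`, i.e. all cookie strengths lie in `[1/2, 1]`. -/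
def IsCookieEnv (ω : CEnv) : Prop := ∀ z i, ω z i ∈ Set.Icc (1/2 : ℝ) 1

/-- The number of visits of the path `x` to the site `x n` at times `m < n`. -/
def prevVisits (x : ℕ → ℤ) (n : ℕ) : ℕ :=
  ((Finset.range n).filter fun m => x m = x n).card

/-- The probability of the step from `x n` to `x (n+1)` for the multi-excited random
walk: jump to the right with the strength of the bottom remaining cookie at the current
site, to the left with the complementary probability. -/
def stepProb (ω : CEnv) (x : ℕ → ℤ) (n : ℕ) : ℝ :=
  if x (n+1) = x n + 1 then ω (x n) (prevVisits x n)
  else if x (n+1) = x n - 1 then 1 - ω (x n) (prevVisits x n)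
  else 0

/-- The probability that the walk started at `x0` follows the path `x` up to time `n`. -/
def cylProb (ω : CEnv) (x0 : ℤ) (x : ℕ → ℤ) (n : ℕ) : ℝ :=
  (if x 0 = x0 then 1 else 0) * ∏ m ∈ Finset.range n, stepProb ω x m

/-- `P` is the law `P_{x0,ω}` of the multi-excited random walk in the cookie
environment `ω` started at `x0`, characterized by its cylinder probabilities. -/
def IsERWLaw (ω : CEnv) (x0 : ℤ) (P : Measure (ℕ → ℤ)) : Prop :=
  IsProbabilityMeasure P ∧
    ∀ (x : ℕ → ℤ) (n : ℕ),
      P {Y | ∀ m ≤ n, Y m = x m} = ENNReal.ofReal (cylProb ω x0 x n)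

/-- First passage time `T_k`, with value `∞` if `k` is never visited. -/
def T (k : ℤ) (Y : ℕ → ℤ) : ℕ∞ :=
  sInf {t : ℕ∞ | ∃ n : ℕ, (n : ℕ∞) = t ∧ Y n = k}

/-- First passage time of an extended-real level, with the convention
`T_{−∞} = T_{+∞} = ∞`. -/
def Te (k : EReal) (Y : ℕ → ℤ) : ℕ∞ :=
  sInf {t : ℕ∞ | ∃ n : ℕ, (n : ℕ∞) = t ∧ ((Y n : ℝ) : EReal) = k}

/-- `R_k`, the event that the site `k` is visited infinitely often. -/
def Rset (k : ℤ) : Set (ℕ → ℤ) := {Y | ∀ N : ℕ, ∃ n ≥ N, Y n = k}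

/-- The number of visits of `Y` to the site `s` at times `< t`. -/
def visitsBefore (Y : ℕ → ℤ) (s : ℤ) (t : ℕ∞) : ℕ∞ :=
  {m : ℕ | (m : ℕ∞) < t ∧ Y m = s}.encard

/-- `D_t^s`: the total drift stored in the cookies consumed at the site `s`
before time `t` (a time in `ℕ∞`; `t = ∞` gives `D_∞^s`). -/
def driftAt (ω : CEnv) (Y : ℕ → ℤ) (s : ℤ) (t : ℕ∞) : ℝ≥0∞ :=
  ∑' i : ℕ, Set.indicator {i : ℕ | (i : ℕ∞) < visitsBefore Y s t}
    (fun i => ENNReal.ofReal (2 * ω s i - 1)) i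

/-- `D_t`: the total drift consumed before time `t` (at all sites). -/
def Dtot (ω : CEnv) (Y : ℕ → ℤ) (t : ℕ∞) : ℝ≥0∞ := ∑' s : ℤ, driftAt ω Y s t

/-- `D_t^+`: the total drift consumed at nonnegative sites before time `t`. -/
def DtotPos (ω : CEnv) (Y : ℕ → ℤ) (t : ℕ∞) : ℝ≥0∞ := ∑' s : ℕ, driftAt ω Y (s : ℤ) t

/-- `δ^s`: the total drift stored in the cookies at the site `s`. -/
def cookieDrift (ω : CEnv) (s : ℤ) : ℝ≥0∞ := ∑' i : ℕ, ENNReal.ofReal (2 * ω s i - 1)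

/-- The successive times `τ_{k,1}, τ_{k,2}, …` (indexed here from `0`) at which the
walk is at a site `≥ k`. -/
def tauT (k : ℤ) (Y : ℕ → ℤ) : ℕ → ℕ∞
  | 0 => sInf {t : ℕ∞ | ∃ n : ℕ, (n : ℕ∞) = t ∧ k ≤ Y n}
  | m + 1 => sInf {t : ℕ∞ | ∃ n : ℕ, (n : ℕ∞) = t ∧ tauT k Y m < (n : ℕ∞) ∧ k ≤ Y n}

/-- The observed sequence `(X_{τ_{k,m}})_{m ≥ 1}` (indexed here from `0`). -/
def obsSeq (k : ℤ) (Y : ℕ → ℤ) (m : ℕ) : ℤ := Y (tauT k Y m).toNat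

/-- The one-sided shift on sequences. -/
def shiftSeq {α : Type*} (u : ℕ → α) : ℕ → α := fun n => u (n + 1)

/-- The restriction `(ω(x))_{x ≥ 0}` of an environment to the nonnegative sites. -/
def restrictNN (ω : CEnv) : ℕ → ℕ → ℝ := fun x => ω (x : ℤ)

/-- `(ω(x))_{x ≥ 0}` is stationary under `Pr`: its law is invariant under the shift. -/
def IsStationaryEnv (Pr : Measure CEnv) : Prop :=
  MeasurePreserving shiftSeq (Pr.map restrictNN) (Pr.map restrictNN)

/-- `(ω(x))_{x ≥ 0}` is stationary and ergodic under `Pr`. -/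
def IsStatErgEnv (Pr : Measure CEnv) : Prop :=
  Ergodic shiftSeq (Pr.map restrictNN)

/-- The process `ξ_k = ((ω(x+k))_{x≥0}, (X_{τ_{k,m}} − k)_{m≥0})` consisting of the
environment to the right of `k` and the trajectory at sites `≥ k`, recentered at `k`. -/
def xiProc (p : CEnv × (ℕ → ℤ)) (k : ℕ) : (ℕ → ℕ → ℝ) × (ℕ → ℤ) :=
  (fun x : ℕ => p.1 ((x : ℤ) + (k : ℤ)), fun m => obsSeq (k : ℤ) p.2 m - (k : ℤ))

/-- Extend a finite path by `0`. -/
def extendPath (n : ℕ) (p : Fin (n + 1) → ℤ) : ℕ → ℤ :=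
  fun m => if h : m < n + 1 then p ⟨m, h⟩ else 0

/-- The paths that stay in `S` up to time `n`. -/
def staySet (S : Set ℤ) (n : ℕ) : Set (ℕ → ℤ) := {Y | ∀ j ≤ n, Y j ∈ S}

/-- The drift of the cookie consumed at time `n`. -/
def driftStep (ω : CEnv) (Y : ℕ → ℤ) (n : ℕ) : ℝ≥0∞ :=
  ENNReal.ofReal (2 * ω (Y n) (prevVisits Y n) - 1)

lemma DependsOn.eq_extendPath {β : Type*} {n : ℕ} {H : (ℕ → ℤ) → β}
    (hH : DependsOn H (Set.Iic n)) (Y : ℕ → ℤ) :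
    H Y = H (extendPath n fun i => Y i) :=
  hH fun m hm => by simp [extendPath, Nat.lt_succ_of_le hm]

lemma DependsOn.measurable_path {n : ℕ} {H : (ℕ → ℤ) → ℝ≥0∞}
    (hH : DependsOn H (Set.Iic n)) : Measurable H := by
  have : H = (H ∘ extendPath n) ∘ fun (Y : ℕ → ℤ) (i : Fin (n + 1)) => Y i :=
    funext fun Y => hH.eq_extendPath Y
  rw [this]
  exact (measurable_of_countable _).comp (measurable_pi_lambda _ fun i => measurable_pi_apply _)

lemma prevVisits_congr {Y Z : ℕ → ℤ} {n : ℕ} (h : ∀ m ≤ n, Y m = Z m) :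
    prevVisits Y n = prevVisits Z n := by
  unfold prevVisits
  congr 1
  refine Finset.filter_congr fun m hm => ?_
  rw [h m (Finset.mem_range.1 hm).le, h n le_rfl]

lemma dependsOn_driftStep (ω : CEnv) (n : ℕ) :
    DependsOn (fun Y => driftStep ω Y n) (Set.Iic n) := fun Y Z h => by
  simp only [driftStep, prevVisits_congr h, h n (Set.mem_Iic.2 le_rfl)]

lemma DependsOn.indicator_staySet {S : Set ℤ} {n : ℕ} {H : (ℕ → ℤ) → ℝ≥0∞}
    (hH : DependsOn H (Set.Iic n)) : DependsOn ((staySet S n).indicator H) (Set.Iic n) := by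
  intro Y Z h
  have : Y ∈ staySet S n ↔ Z ∈ staySet S n :=
    forall₂_congr fun j hj => by rw [h j hj]
  by_cases hZ : Z ∈ staySet S n
  · rw [Set.indicator_of_mem hZ, Set.indicator_of_mem (this.2 hZ), hH h]
  · rw [Set.indicator_of_notMem hZ, Set.indicator_of_notMem (mt this.1 hZ)]

lemma lintegral_eq_tsum_extendPath {ω : CEnv} {x : ℤ} {P : Measure (ℕ → ℤ)} (hP : IsERWLaw ω x P)
    {n : ℕ} {H : (ℕ → ℤ) → ℝ≥0∞} (hH : DependsOn H (Set.Iic n)) :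
    ∫⁻ Y, H Y ∂P = ∑' p : Fin (n + 1) → ℤ,
      H (extendPath n p) * ENNReal.ofReal (cylProb ω x (extendPath n p) n) := by
  have hr : Measurable fun (Y : ℕ → ℤ) (i : Fin (n + 1)) => Y i :=
    measurable_pi_lambda _ fun i => measurable_pi_apply _
  calc ∫⁻ Y, H Y ∂P = ∫⁻ Y, (H ∘ extendPath n) (fun i : Fin (n + 1) => Y i) ∂P :=
        lintegral_congr fun Y => hH.eq_extendPath Y
    _ = ∫⁻ p, (H ∘ extendPath n) p ∂(P.map fun (Y : ℕ → ℤ) (i : Fin (n + 1)) => Y i) :=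
        (lintegral_map (measurable_of_countable _) hr).symm
    _ = _ := by
      rw [lintegral_countable']
      refine tsum_congr fun p => ?_
      rw [Measure.map_apply hr (measurableSet_singleton p), ← hP.2]
      congr 2
      ext Y
      simp only [Set.mem_preimage, Set.mem_singleton_iff, Set.mem_ofPred_eq, funext_iff]
      constructor
      · intro h m hm
        simpa [extendPath, Nat.lt_succ_of_le hm] using h ⟨m, Nat.lt_succ_of_le hm⟩
      · rintro h ⟨i, hi⟩
        simpa [extendPath, hi] using h i (Nat.le_of_lt_succ hi)

lemma extendPath_snoc (n : ℕ) (p : Fin (n + 1) → ℤ) (z : ℤ) :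
    extendPath (n + 1) (Fin.snoc (α := fun _ => ℤ) p z) =
      Function.update (extendPath n p) (n + 1) z := by
  funext m
  rcases lt_trichotomy m (n + 1) with h | h | h
  · rw [Function.update_of_ne h.ne]
    have h' : m < n + 1 + 1 := by omega
    simp [extendPath, h, h', Fin.snoc]
  · subst h
    simp [extendPath, Fin.snoc]
  · rw [Function.update_of_ne h.ne']
    have h1 : ¬ m < n + 1 + 1 := by omega
    have h2 : ¬ m < n + 1 := by omega
    simp only [extendPath, h1, h2, dif_neg, not_false_eq_true]

lemma update_succ_apply_of_le {n m : ℕ} (hm : m ≤ n) (Y : ℕ → ℤ) (z : ℤ) :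
    Function.update Y (n + 1) z m = Y m :=
  Function.update_of_ne (by omega) _ _

lemma cylProb_update (ω : CEnv) (x : ℤ) (Y : ℕ → ℤ) (n : ℕ) (z : ℤ) :
    cylProb ω x (Function.update Y (n + 1) z) (n + 1) = cylProb ω x Y n *
      (if z = Y n + 1 then ω (Y n) (prevVisits Y n)
        else if z = Y n - 1 then 1 - ω (Y n) (prevVisits Y n) else 0) := by
  have hv : ∀ m ≤ n, prevVisits (Function.update Y (n + 1) z) m = prevVisits Y m := fun m hm =>
    prevVisits_congr fun j hj => update_succ_apply_of_le (hj.trans hm) Y z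
  rw [cylProb, Finset.prod_range_succ, ← mul_assoc]
  congr 1
  · rw [cylProb, update_succ_apply_of_le (Nat.zero_le n)]
    congr 1
    refine Finset.prod_congr rfl fun m hm => ?_
    have hm := Finset.mem_range.1 hm
    rw [stepProb, stepProb, hv m hm.le, update_succ_apply_of_le hm.le,
      update_succ_apply_of_le (Nat.succ_le_of_lt hm)]
  · rw [stepProb, hv n le_rfl, update_succ_apply_of_le le_rfl, Function.update_self]

/-- The Markov property of the walk together with its history. -/
lemma lintegral_step {ω : CEnv} (hω : IsCookieEnv ω) {x : ℤ} {P : Measure (ℕ → ℤ)}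
    (hP : IsERWLaw ω x P) {n : ℕ} {H : (ℕ → ℤ) → ℝ≥0∞} (hH : DependsOn H (Set.Iic (n + 1))) :
    ∫⁻ Y, H Y ∂P = ∫⁻ Y,
      (ENNReal.ofReal (ω (Y n) (prevVisits Y n)) * H (Function.update Y (n + 1) (Y n + 1)) +
      ENNReal.ofReal (1 - ω (Y n) (prevVisits Y n)) *
        H (Function.update Y (n + 1) (Y n - 1))) ∂P := by
  have hdep : DependsOn (fun Y : ℕ → ℤ =>
      ENNReal.ofReal (ω (Y n) (prevVisits Y n)) * H (Function.update Y (n + 1) (Y n + 1)) +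
      ENNReal.ofReal (1 - ω (Y n) (prevVisits Y n)) *
        H (Function.update Y (n + 1) (Y n - 1))) (Set.Iic n) := by
    intro Y Z h
    have hu : ∀ z, H (Function.update Y (n + 1) z) = H (Function.update Z (n + 1) z) := by
      intro z
      refine hH fun m hm => ?_
      rcases Nat.lt_or_eq_of_le (Set.mem_Iic.1 hm) with h' | rfl
      · rw [update_succ_apply_of_le (by omega), update_succ_apply_of_le (by omega)]
        exact h m (Set.mem_Iic.2 (by omega))
      · simp
    simp only [prevVisits_congr h, h n (Set.mem_Iic.2 le_rfl), hu]
  rw [lintegral_eq_tsum_extendPath hP hH, lintegral_eq_tsum_extendPath hP hdep,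
    ← (Fin.snocEquiv fun _ : Fin (n + 1 + 1) => ℤ).tsum_eq, ENNReal.tsum_prod',
    ENNReal.tsum_comm]
  refine tsum_congr fun p => ?_
  have hE : ∀ z, extendPath (n + 1) ((Fin.snocEquiv fun _ : Fin (n + 1 + 1) => ℤ) (z, p)) =
      Function.update (extendPath n p) (n + 1) z := fun z => extendPath_snoc n p z
  simp only [hE, cylProb_update]
  generalize extendPath n p = Y
  have hc : 0 ≤ cylProb ω x Y n := by
    refine mul_nonneg (by split_ifs <;> norm_num) (Finset.prod_nonneg fun m _ => ?_)
    have := hω (Y m) (prevVisits Y m)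
    rw [stepProb]
    split_ifs <;> linarith [this.1, this.2]
  rw [tsum_eq_sum (s := {Y n + 1, Y n - 1})]
  · rw [Finset.sum_pair (by omega), if_pos rfl, if_neg (by omega), if_pos rfl,
      ENNReal.ofReal_mul hc, ENNReal.ofReal_mul hc]
    ring
  · intro z hz
    simp only [Finset.mem_insert, Finset.mem_singleton, not_or] at hz
    simp [hz.1, hz.2]

lemma mem_staySet_succ {S : Set ℤ} {n : ℕ} {Y : ℕ → ℤ} :
    Y ∈ staySet S (n + 1) ↔ Y ∈ staySet S n ∧ Y (n + 1) ∈ S := by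
  refine ⟨fun h => ⟨fun j hj => h j (by omega), h _ le_rfl⟩, fun h j hj => ?_⟩
  rcases Nat.lt_or_eq_of_le hj with h' | rfl
  · exact h.1 j (by omega)
  · exact h.2

lemma lintegral_staySet_succ {ω : CEnv} (hω : IsCookieEnv ω) {x : ℤ} {P : Measure (ℕ → ℤ)}
    (hP : IsERWLaw ω x P) (S : Set ℤ) (g : ℤ → ℝ≥0∞) (n : ℕ) :
    ∫⁻ Y, (staySet S (n + 1)).indicator (fun Y => g (Y (n + 1))) Y ∂P =
      ∫⁻ Y, (staySet S n).indicator (fun Y =>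
        ENNReal.ofReal (ω (Y n) (prevVisits Y n)) * S.indicator g (Y n + 1) +
        ENNReal.ofReal (1 - ω (Y n) (prevVisits Y n)) * S.indicator g (Y n - 1)) Y ∂P := by
  have hdep : DependsOn (fun Y : ℕ → ℤ => g (Y (n + 1))) (Set.Iic (n + 1)) :=
    fun Y Z h => by simp only [h (n + 1) (Set.mem_Iic.2 le_rfl)]
  rw [lintegral_step hω hP hdep.indicator_staySet]
  refine lintegral_congr fun Y => ?_
  have key : ∀ z, (staySet S (n + 1)).indicator (fun Y => g (Y (n + 1)))
      (Function.update Y (n + 1) z) =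
      (staySet S n).indicator (fun _ => S.indicator g z) Y := by
    classical
    intro z
    have h1 : Function.update Y (n + 1) z ∈ staySet S n ↔ Y ∈ staySet S n :=
      forall₂_congr fun j hj => by rw [update_succ_apply_of_le hj]
    simp only [Set.indicator_apply, mem_staySet_succ, h1, Function.update_self]
    split_ifs <;> simp_all
  rw [key, key]
  by_cases hY : Y ∈ staySet S n <;> simp [hY]

lemma ae_path {ω : CEnv} (hω : IsCookieEnv ω) {x : ℤ} {P : Measure (ℕ → ℤ)}
    (hP : IsERWLaw ω x P) :
    ∀ᵐ Y ∂P, Y 0 = x ∧ ∀ n, Y (n + 1) = Y n + 1 ∨ Y (n + 1) = Y n - 1 := by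
  have := hP.1
  rw [eventually_and, ae_all_iff]
  constructor
  · have h := hP.2 (fun _ => x) 0
    have h1 : {Y : ℕ → ℤ | ∀ m ≤ 0, Y m = x} = (fun Y : ℕ → ℤ => Y 0) ⁻¹' {x} := by ext; simp
    rw [h1] at h
    have hm : MeasurableSet ((fun Y : ℕ → ℤ => Y 0) ⁻¹' {x}) :=
      measurable_pi_apply 0 (measurableSet_singleton x)
    exact (mem_ae_iff_prob_eq_one hm).2 (by rw [h]; simp [cylProb])
  · intro n
    set B : Set (ℕ → ℤ) := {Y | ¬ (Y (n + 1) = Y n + 1 ∨ Y (n + 1) = Y n - 1)} with hB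
    have hdep : DependsOn (B.indicator (1 : (ℕ → ℤ) → ℝ≥0∞)) (Set.Iic (n + 1)) := by
      intro Y Z h
      have : Y ∈ B ↔ Z ∈ B := by
        simp only [hB, Set.mem_ofPred_eq, h n (Set.mem_Iic.2 (by omega)),
          h (n + 1) (Set.mem_Iic.2 le_rfl)]
      simp only [Set.indicator_apply, this, Pi.one_apply]
    have h0 := lintegral_step hω hP hdep
    have hz : ∀ Y : ℕ → ℤ, B.indicator (1 : (ℕ → ℤ) → ℝ≥0∞)
        (Function.update Y (n + 1) (Y n + 1)) = 0 ∧ B.indicator (1 : (ℕ → ℤ) → ℝ≥0∞)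
        (Function.update Y (n + 1) (Y n - 1)) = 0 := by
      intro Y
      constructor <;> refine Set.indicator_of_notMem ?_ _ <;>
        simp [hB]
    simp only [hz, mul_zero, add_zero, lintegral_zero] at h0
    rw [lintegral_eq_zero_iff hdep.measurable_path] at h0
    filter_upwards [h0] with Y hY
    by_contra hc
    have : Y ∈ B := hc
    simp [this] at hY

lemma exists_le_eq_of_path {x : ℤ} {Y : ℕ → ℤ} (h0 : Y 0 = x)
    (hs : ∀ n, Y (n + 1) = Y n + 1 ∨ Y (n + 1) = Y n - 1) (n : ℕ) {s : ℤ} (h1 : Y n ≤ s)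
    (h2 : s ≤ x) : ∃ j ≤ n, Y j = s := by
  induction n with
  | zero => exact ⟨0, le_rfl, by omega⟩
  | succ n ih =>
    by_cases h : Y (n + 1) = s
    · exact ⟨n + 1, le_rfl, h⟩
    · obtain ⟨j, hj, hjs⟩ := ih (by rcases hs n with h' | h' <;> omega)
      exact ⟨j, by omega, hjs⟩

lemma mem_staySet_Iio_iff {x k : ℤ} (hk : x ≤ k) {Y : ℕ → ℤ} (h0 : Y 0 = x)
    (hs : ∀ n, Y (n + 1) = Y n + 1 ∨ Y (n + 1) = Y n - 1) (n : ℕ) :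
    Y ∈ staySet {k}ᶜ n ↔ Y ∈ staySet (Set.Iio k) n := by
  constructor
  · intro h j hj
    have h' : ∀ j ≤ n, Y j ≠ k := h
    show Y j < k
    induction j with
    | zero => have := h' 0 hj; omega
    | succ j ih => have := h' _ hj; have := ih (by omega); rcases hs j with h | h <;> omega
  · exact fun h j hj => ne_of_lt (h j hj)

lemma natCast_lt_T_iff {k : ℤ} {Y : ℕ → ℤ} {n : ℕ} :
    (n : ℕ∞) < T k Y ↔ Y ∈ staySet {k}ᶜ n := by
  constructor
  · intro h j hj hjk
    have : T k Y ≤ j := sInf_le ⟨j, rfl, hjk⟩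
    exact absurd (h.trans_le this) (by simpa using hj)
  · intro h
    have : ((n + 1 : ℕ) : ℕ∞) ≤ T k Y := by
      refine le_sInf ?_
      rintro _ ⟨j, rfl, hj⟩
      by_contra hc
      exact h j (by have := not_le.1 hc; norm_cast at this; omega) hj
    exact lt_of_lt_of_le (by norm_cast; omega) this

lemma setOf_lt_visitsBefore (Y : ℕ → ℤ) (s : ℤ) (t : ℕ∞) :
    {i : ℕ | (i : ℕ∞) < visitsBefore Y s t} =
      Nat.count (fun m => Y m = s) '' {m : ℕ | (m : ℕ∞) < t ∧ Y m = s} := by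
  classical
  ext i
  simp only [Set.mem_ofPred_eq, Set.mem_image, visitsBefore]
  constructor
  · intro hi
    have hf : ∀ hf : {m : ℕ | (m : ℕ∞) < t ∧ Y m = s}.Finite, i < hf.toFinset.card := by
      intro hf
      rw [hf.encard_eq_coe_toFinset_card] at hi
      exact_mod_cast hi
    have hmem := Nat.nth_mem i hf
    refine ⟨_, hmem, ?_⟩
    conv_rhs => rw [← Nat.count_nth hf]
    rw [Nat.count_eq_card_filter_range, Nat.count_eq_card_filter_range]
    congr 1
    refine Finset.filter_congr fun m hm => ?_
    have hlt : (m : ℕ∞) < t :=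
      lt_trans (by exact_mod_cast Finset.mem_range.1 hm) hmem.1
    simp [hlt]
  · rintro ⟨m, ⟨hm, hs⟩, rfl⟩
    have hsub : (((Finset.range (m + 1)).filter fun j => Y j = s : Finset ℕ) : Set ℕ) ⊆
        {m : ℕ | (m : ℕ∞) < t ∧ Y m = s} := by
      intro j hj
      simp only [Finset.coe_filter, Finset.mem_range, Set.mem_ofPred_eq] at hj
      exact ⟨lt_of_le_of_lt (by exact_mod_cast Nat.le_of_lt_succ hj.1) hm, hj.2⟩
    refine lt_of_lt_of_le ?_ (Set.encard_le_encard hsub)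
    rw [Set.encard_coe_eq_coe_finsetCard, ← Nat.count_eq_card_filter_range, Nat.count_succ,
      if_pos hs]
    norm_cast
    omega

lemma driftAt_eq_tsum (ω : CEnv) (Y : ℕ → ℤ) (s : ℤ) (t : ℕ∞) :
    driftAt ω Y s t = ∑' m : ℕ, {m : ℕ | (m : ℕ∞) < t ∧ Y m = s}.indicator (driftStep ω Y) m := by
  rw [driftAt, ← tsum_subtype, setOf_lt_visitsBefore, ← tsum_subtype,
    tsum_image (f := fun i => ENNReal.ofReal (2 * ω s i - 1))]
  · refine tsum_congr fun m => ?_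
    obtain ⟨m, -, rfl⟩ := m
    rw [driftStep, prevVisits, Nat.count_eq_card_filter_range]
  · exact fun a ha b hb h => Nat.count_injective ha.2 hb.2 h

lemma Dtot_eq_tsum (ω : CEnv) (Y : ℕ → ℤ) (t : ℕ∞) :
    Dtot ω Y t = ∑' m : ℕ, {m : ℕ | (m : ℕ∞) < t}.indicator (driftStep ω Y) m := by
  simp only [Dtot, driftAt_eq_tsum]
  rw [ENNReal.tsum_comm]
  refine tsum_congr fun m => ?_
  rw [tsum_eq_single (Y m)]
  · simp [Set.indicator_apply]
  · intro s hs
    simp [hs.symm]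

lemma Dtot_T_eq_tsum {x k : ℤ} (hk : x ≤ k) (ω : CEnv) {Y : ℕ → ℤ} (h0 : Y 0 = x)
    (hs : ∀ n, Y (n + 1) = Y n + 1 ∨ Y (n + 1) = Y n - 1) :
    Dtot ω Y (T k Y) =
      ∑' m : ℕ, (staySet (Set.Iio k) m).indicator (fun Y => driftStep ω Y m) Y := by
  rw [Dtot_eq_tsum]
  refine tsum_congr fun m => ?_
  have : m ∈ {m : ℕ | (m : ℕ∞) < T k Y} ↔ Y ∈ staySet (Set.Iio k) m :=
    natCast_lt_T_iff.trans (mem_staySet_Iio_iff hk h0 hs m)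
  by_cases h : Y ∈ staySet (Set.Iio k) m
  · rw [Set.indicator_of_mem h, Set.indicator_of_mem (this.2 h)]
  · rw [Set.indicator_of_notMem h, Set.indicator_of_notMem (mt this.1 h)]

/-- The first cookies of all sites between the current position and the start are consumed. -/
lemma sum_le_Dtot_T {x k : ℤ} (ω : CEnv) {Y : ℕ → ℤ} (h0 : Y 0 = x)
    (hs : ∀ n, Y (n + 1) = Y n + 1 ∨ Y (n + 1) = Y n - 1) {n : ℕ} (hn : (n : ℕ∞) < T k Y) :
    ∑ s ∈ Finset.Icc (Y n) x, ENNReal.ofReal (2 * ω s 0 - 1) ≤ Dtot ω Y (T k Y) := by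
  refine le_trans (Finset.sum_le_sum fun s hsI => ?_) (ENNReal.sum_le_tsum (Finset.Icc (Y n) x))
  rw [Finset.mem_Icc] at hsI
  obtain ⟨j, hj, hjs⟩ := exists_le_eq_of_path h0 hs n hsI.1 hsI.2
  have hv : (0 : ℕ∞) < visitsBefore Y s (T k Y) := by
    rw [visitsBefore, Set.encard_pos]
    exact ⟨j, lt_of_le_of_lt (by exact_mod_cast hj) hn, hjs⟩
  refine le_trans (le_of_eq ?_) (ENNReal.le_tsum 0)
  rw [Set.indicator_of_mem]
  simpa using hv

lemma exists_linear_bound {ω : CEnv} (hω : IsCookieEnv ω)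
    (hpine : 0 < Filter.atTop.liminf (fun i : ℕ =>
      (1 / (i : ℝ)) * ∑ j ∈ Finset.range (i + 1), (2 * ω (-(j : ℤ)) 0 - 1))) (x k : ℤ) :
    ∃ A B : ℝ, 0 ≤ A ∧ 0 ≤ B ∧ ∀ y : ℤ,
      (k : ℝ) - y ≤ A + B * ∑ s ∈ Finset.Icc y x, (2 * ω s 0 - 1) := by
  obtain ⟨c, hc, hcl⟩ := exists_between hpine
  have hnn : ∀ s, 0 ≤ 2 * ω s 0 - 1 := fun s => by linarith [(hω s 0).1]
  have hle : ∀ s, 2 * ω s 0 - 1 ≤ 1 := fun s => by linarith [(hω s 0).2]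
  have hev := Filter.eventually_lt_of_lt_liminf hcl
    (isBoundedUnder_of ⟨0, fun i => mul_nonneg (by positivity)
      (Finset.sum_nonneg fun j _ => hnn _)⟩)
  obtain ⟨N, hN⟩ := Filter.eventually_atTop.1 hev
  refine ⟨|(k : ℝ)| + |(x : ℝ)| + (N + 1) + c⁻¹ * (|(x : ℝ)| + 1), c⁻¹, by positivity,
    by positivity, fun y => ?_⟩
  have hS : 0 ≤ ∑ s ∈ Finset.Icc y x, (2 * ω s 0 - 1) := Finset.sum_nonneg fun s _ => hnn s
  have hk' := le_abs_self (k : ℝ)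
  have hx0 := abs_nonneg (x : ℝ)
  have hX : 0 ≤ c⁻¹ * (|(x : ℝ)| + 1) := by positivity
  have hcS : 0 ≤ c⁻¹ * ∑ s ∈ Finset.Icc y x, (2 * ω s 0 - 1) := by positivity
  by_cases hy : -((N : ℤ) + 1) ≤ y
  · have : -((N : ℝ) + 1) ≤ y := by exact_mod_cast hy
    linarith
  · obtain ⟨i, rfl⟩ : ∃ i : ℕ, y = -(i : ℤ) := ⟨y.natAbs, by omega⟩
    have hiN : N ≤ i := by omega
    have hi0 : (0 : ℝ) < i := by exact_mod_cast (show 0 < i by omega)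
    have h1 := hN i hiN
    rw [one_div, inv_mul_eq_div, lt_div_iff₀ hi0] at h1
    have h2 : ∑ j ∈ Finset.range (i + 1), (2 * ω (-(j : ℤ)) 0 - 1) =
        ∑ s ∈ Finset.Icc (-(i : ℤ)) 0, (2 * ω s 0 - 1) := by
      refine Finset.sum_bij (fun j _ => -(j : ℤ)) ?_ ?_ ?_ ?_
      · intro j hj
        simp only [Finset.mem_range, Finset.mem_Icc] at *
        omega
      · intro a _ b _ h
        simpa using h
      · intro s hs
        simp only [Finset.mem_range, Finset.mem_Icc] at *
        exact ⟨s.natAbs, by omega, by omega⟩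
      · intros
        rfl
    have h3 : ∑ s ∈ Finset.Icc (-(i : ℤ)) 0, (2 * ω s 0 - 1) ≤
        ∑ s ∈ Finset.Icc (-(i : ℤ)) x, (2 * ω s 0 - 1) +
          ∑ s ∈ Finset.Icc x 0, (2 * ω s 0 - 1) := by
      refine le_trans (Finset.sum_le_sum_of_subset_of_nonneg
        (t := Finset.Icc (-(i : ℤ)) x ∪ Finset.Icc x 0) ?_ fun s _ _ => hnn s) ?_
      · intro s hs
        simp only [Finset.mem_union, Finset.mem_Icc] at *
        omega
      · rw [← Finset.sum_union_inter]
        exact le_add_of_nonneg_right (Finset.sum_nonneg fun s _ => hnn s)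
    have h4 : ∑ s ∈ Finset.Icc x 0, (2 * ω s 0 - 1) ≤ |(x : ℝ)| + 1 := by
      refine le_trans (Finset.sum_le_card_nsmul _ _ 1 fun s _ => hle s) ?_
      rw [Int.card_Icc, nsmul_eq_mul, mul_one]
      have : ((0 + 1 - x).toNat : ℤ) ≤ |x| + 1 := by
        have := neg_abs_le x; have := abs_nonneg x; omega
      exact_mod_cast this
    have h5 : (i : ℝ) ≤
        c⁻¹ * (∑ s ∈ Finset.Icc (-(i : ℤ)) x, (2 * ω s 0 - 1) + (|(x : ℝ)| + 1)) := by
      rw [inv_mul_eq_div, le_div_iff₀ hc]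
      linarith
    push_cast
    have : (0 : ℝ) ≤ N := by positivity
    linarith

/-- The walk leaves every bounded interval almost surely. -/
lemma ae_exists_notMem_staySet_Ioo {ω : CEnv} (hω : IsCookieEnv ω) {x : ℤ}
    {P : Measure (ℕ → ℤ)} (hP : IsERWLaw ω x P) (a b : ℤ) :
    ∀ᵐ Y ∂P, ∃ n, Y ∉ staySet (Set.Ioo a b) n := by
  have := hP.1
  set S := Set.Ioo a b
  set g : ℤ → ℝ≥0∞ := fun z => ENNReal.ofReal (((b - a : ℤ) : ℝ) ^ 2 - ((z - a : ℤ) : ℝ) ^ 2)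
  set U : ℕ → (ℕ → ℤ) → ℝ≥0∞ := fun n => (staySet S n).indicator fun Y => g (Y n)
  have hdep1 : ∀ n, DependsOn (fun _ : ℕ → ℤ => (1 : ℝ≥0∞)) (Set.Iic n) := fun n Y Z _ => rfl
  have hm : ∀ n, Measurable ((staySet S n).indicator fun _ : ℕ → ℤ => (1 : ℝ≥0∞)) :=
    fun n => (hdep1 n).indicator_staySet.measurable_path
  have hmeas : ∀ n, MeasurableSet (staySet S n) := fun n =>
    (measurable_indicator_const_iff (1 : ℝ≥0∞)).1 (hm n)
  have hstep : ∀ n, P (staySet S n) + ∫⁻ Y, U (n + 1) Y ∂P ≤ ∫⁻ Y, U n Y ∂P := by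
    intro n
    have hone : P (staySet S n) = ∫⁻ Y, (staySet S n).indicator (fun _ => 1) Y ∂P :=
      (lintegral_indicator_one (hmeas n)).symm
    rw [lintegral_staySet_succ hω hP, hone, ← lintegral_add_left (hm n)]
    refine lintegral_mono fun Y => ?_
    by_cases hY : Y ∈ staySet S n
    · simp only [U, Set.indicator_of_mem hY]
      have hYn : Y n ∈ S := hY n le_rfl
      obtain ⟨hw1, hw2⟩ := hω (Y n) (prevVisits Y n)
      set w := ω (Y n) (prevVisits Y n)
      have ha : (a : ℝ) + 1 ≤ Y n := by exact_mod_cast hYn.1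
      have hb : (Y n : ℝ) + 1 ≤ b := by exact_mod_cast hYn.2
      calc 1 + (ENNReal.ofReal w * S.indicator g (Y n + 1) +
              ENNReal.ofReal (1 - w) * S.indicator g (Y n - 1))
          ≤ 1 + (ENNReal.ofReal w * g (Y n + 1) + ENNReal.ofReal (1 - w) * g (Y n - 1)) := by
            gcongr <;> exact Set.indicator_le_self _ _ _
        _ = ENNReal.ofReal (1 + (w * (((b - a : ℤ) : ℝ) ^ 2 - ((Y n + 1 - a : ℤ) : ℝ) ^ 2) +
              (1 - w) * (((b - a : ℤ) : ℝ) ^ 2 - ((Y n - 1 - a : ℤ) : ℝ) ^ 2))) := by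
            have p1 : 0 ≤ ((b - a : ℤ) : ℝ) ^ 2 - ((Y n + 1 - a : ℤ) : ℝ) ^ 2 := by
              push_cast; nlinarith
            have p2 : 0 ≤ ((b - a : ℤ) : ℝ) ^ 2 - ((Y n - 1 - a : ℤ) : ℝ) ^ 2 := by
              push_cast; nlinarith
            have q1 : 0 ≤ w := by linarith
            have q2 : 0 ≤ 1 - w := by linarith
            rw [ENNReal.ofReal_add (by norm_num) (by positivity),
              ENNReal.ofReal_add (by positivity) (by positivity), ENNReal.ofReal_mul q1,
              ENNReal.ofReal_mul q2, ENNReal.ofReal_one]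
        _ ≤ g (Y n) := by
            refine ENNReal.ofReal_le_ofReal ?_
            push_cast
            nlinarith
    · simp [U, hY]
  have hsum : ∀ n, ∑ m ∈ Finset.range n, P (staySet S m) + ∫⁻ Y, U n Y ∂P ≤ ∫⁻ Y, U 0 Y ∂P := by
    intro n
    induction n with
    | zero => simp
    | succ n ih =>
      rw [Finset.sum_range_succ, add_assoc]
      exact le_trans (add_le_add_right (hstep n) _) ih
  have hU0 : ∫⁻ Y, U 0 Y ∂P ≠ ⊤ := by
    refine ne_top_of_le_ne_top (b := ENNReal.ofReal (((b - a : ℤ) : ℝ) ^ 2))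
      ENNReal.ofReal_ne_top ?_
    refine le_trans (lintegral_mono (g := fun _ => ENNReal.ofReal (((b - a : ℤ) : ℝ) ^ 2))
      fun Y => ?_) (by simp)
    refine le_trans (Set.indicator_le_self _ _ _) (ENNReal.ofReal_le_ofReal ?_)
    linarith [sq_nonneg ((Y 0 - a : ℤ) : ℝ)]
  have htop : ∑' n, P (staySet S n) ≠ ⊤ := by
    refine ne_top_of_le_ne_top hU0 ?_
    rw [ENNReal.tsum_eq_iSup_nat]
    exact iSup_le fun n => le_trans le_self_add (hsum n)
  filter_upwards [ae_finite_setOfPred_mem htop] with Y hY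
  by_contra! hc
  exact Set.infinite_univ (hY.subset fun n _ => hc n)

/-- Optional stopping for the martingale given by the position minus the consumed drift. -/
lemma sum_lintegral_driftStep_add {ω : CEnv} (hω : IsCookieEnv ω) {x k : ℤ}
    {P : Measure (ℕ → ℤ)} (hP : IsERWLaw ω x P) (hk : x ≤ k) (n : ℕ) :
    ∑ m ∈ Finset.range n,
        ∫⁻ Y, (staySet (Set.Iio k) m).indicator (fun Y => driftStep ω Y m) Y ∂P +
      ∫⁻ Y, (staySet (Set.Iio k) n).indicator (fun Y => ENNReal.ofReal ((k : ℝ) - Y n)) Y ∂P =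
      ENNReal.ofReal ((k : ℝ) - x) := by
  have := hP.1
  induction n with
  | zero =>
    have : ∀ᵐ Y ∂P, (staySet (Set.Iio k) 0).indicator
        (fun Y : ℕ → ℤ => ENNReal.ofReal ((k : ℝ) - Y 0)) Y = ENNReal.ofReal ((k : ℝ) - x) := by
      filter_upwards [ae_path hω hP] with Y hY
      by_cases h : Y ∈ staySet (Set.Iio k) 0
      · rw [Set.indicator_of_mem h, hY.1]
      · rw [Set.indicator_of_notMem h]
        have hxk : x = k := by
          by_contra hne
          refine h fun j hj => ?_
          obtain rfl : j = 0 := by omega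
          show Y 0 < k
          have := hY.1
          omega
        simp [hxk]
    simp [lintegral_congr_ae this]
  | succ n ih =>
    rw [← ih, Finset.sum_range_succ, add_assoc]
    congr 1
    rw [lintegral_staySet_succ hω hP (Set.Iio k) fun z => ENNReal.ofReal ((k : ℝ) - z),
      ← lintegral_add_left (dependsOn_driftStep ω n).indicator_staySet.measurable_path]
    refine lintegral_congr fun Y => ?_
    have hind : (Set.Iio k).indicator (fun z : ℤ => ENNReal.ofReal ((k : ℝ) - z)) =
        fun z : ℤ => ENNReal.ofReal ((k : ℝ) - z) := by
      refine Set.indicator_eq_self.2 fun z hz => ?_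
      by_contra hc
      refine hz (ENNReal.ofReal_of_nonpos ?_)
      have : (k : ℝ) ≤ z := by exact_mod_cast not_lt.1 hc
      linarith
    by_cases hY : Y ∈ staySet (Set.Iio k) n
    · simp only [Set.indicator_of_mem hY, hind, driftStep]
      have hYn : Y n < k := hY n le_rfl
      have hYr : (Y n : ℝ) + 1 ≤ k := by exact_mod_cast hYn
      obtain ⟨hw1, hw2⟩ := hω (Y n) (prevVisits Y n)
      set w := ω (Y n) (prevVisits Y n)
      push_cast
      have q1 : 0 ≤ w := by linarith
      have q2 : 0 ≤ 1 - w := by linarith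
      have p1 : 0 ≤ (k : ℝ) - (Y n + 1) := by linarith
      have p2 : 0 ≤ (k : ℝ) - (Y n - 1) := by linarith
      rw [← ENNReal.ofReal_mul q1, ← ENNReal.ofReal_mul q2,
        ← ENNReal.ofReal_add (by positivity) (by positivity),
        ← ENNReal.ofReal_add (by linarith) (by positivity)]
      congr 1
      ring
    · simp [hY]

/-- Lemma 2. If
`liminf_{i→∞} (1/i) ∑_{y=-i}^{0} (2ω(y,1) − 1) > 0`, then for all `x ≤ k`,
`E_{x,ω}[D_{T_k}] = k − x`. -/
theorem erw_expected_drift (ω : CEnv) (hω : IsCookieEnv ω)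
    (hpine : 0 < Filter.atTop.liminf (fun i : ℕ =>
      (1 / (i : ℝ)) * ∑ j ∈ Finset.range (i + 1), (2 * ω (-(j : ℤ)) 0 - 1)))
    (x k : ℤ) (hk : x ≤ k)
    (P : Measure (ℕ → ℤ)) (hP : IsERWLaw ω x P) :
    ∫⁻ Y, Dtot ω Y (T k Y) ∂P = ENNReal.ofReal ((k : ℝ) - (x : ℝ)) := by
  have := hP.1
  obtain ⟨A, B, hA, hB, hAB⟩ := exists_linear_bound hω hpine x k
  set C : ℕ → (ℕ → ℤ) → ℝ≥0∞ := fun n =>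
    (staySet (Set.Iio k) n).indicator fun Y => driftStep ω Y n with hC
  set W : ℕ → (ℕ → ℤ) → ℝ≥0∞ := fun n =>
    (staySet (Set.Iio k) n).indicator fun Y => ENNReal.ofReal ((k : ℝ) - Y n) with hW
  have hCm : ∀ n, Measurable (C n) := fun n =>
    (dependsOn_driftStep ω n).indicator_staySet.measurable_path
  have hWm : ∀ n, Measurable (W n) := fun n =>
    DependsOn.measurable_path (n := n) (DependsOn.indicator_staySet fun Y Z h => by
      simp only [h n (Set.mem_Iic.2 le_rfl)])
  have hpath := ae_path hω hP
  have hD : ∀ᵐ Y ∂P, Dtot ω Y (T k Y) = ∑' n, C n Y := by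
    filter_upwards [hpath] with Y hY
    exact Dtot_T_eq_tsum hk ω hY.1 hY.2
  have hsum := sum_lintegral_driftStep_add hω hP hk
  have hDint : ∫⁻ Y, Dtot ω Y (T k Y) ∂P = ∑' n, ∫⁻ Y, C n Y ∂P := by
    rw [lintegral_congr_ae hD, lintegral_tsum fun n => (hCm n).aemeasurable]
  have hfin : ∫⁻ Y, ∑' n, C n Y ∂P ≠ ⊤ := by
    rw [lintegral_tsum fun n => (hCm n).aemeasurable, ENNReal.tsum_eq_iSup_nat]
    exact ne_top_of_le_ne_top ENNReal.ofReal_ne_top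
      (iSup_le fun n => le_trans le_self_add (hsum n).le)
  have hDm : Measurable fun Y => ∑' n, C n Y := Measurable.tsum hCm
  set G : (ℕ → ℤ) → ℝ≥0∞ := fun Y =>
    ENNReal.ofReal A + ENNReal.ofReal B * ∑' n, C n Y with hG
  have hGfin : ∫⁻ Y, G Y ∂P ≠ ⊤ := by
    rw [hG, lintegral_add_left measurable_const, lintegral_const_mul _ hDm, lintegral_const,
      measure_univ, mul_one]
    exact ENNReal.add_ne_top.2 ⟨ENNReal.ofReal_ne_top,
      ENNReal.mul_ne_top ENNReal.ofReal_ne_top hfin⟩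
  have hbound : ∀ᵐ Y ∂P, ∀ n, W n Y ≤ G Y := by
    filter_upwards [hpath, hD] with Y hY hDY n
    by_cases h : Y ∈ staySet (Set.Iio k) n
    · have hn := natCast_lt_T_iff.2 ((mem_staySet_Iio_iff hk hY.1 hY.2 n).2 h)
      have hs := sum_le_Dtot_T ω hY.1 hY.2 hn
      have hnn : ∀ s, 0 ≤ 2 * ω s 0 - 1 := fun s => by linarith [(hω s 0).1]
      rw [hDY, ← ENNReal.ofReal_sum_of_nonneg fun s _ => hnn s] at hs
      simp only [hW, hG, Set.indicator_of_mem h]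
      refine (ENNReal.ofReal_le_ofReal (hAB (Y n))).trans ?_
      rw [ENNReal.ofReal_add hA (mul_nonneg hB (Finset.sum_nonneg fun s _ => hnn s)),
        ENNReal.ofReal_mul hB]
      gcongr
    · simp [hW, h]
  have hlim : ∀ᵐ Y ∂P, Tendsto (fun n => W n Y) atTop (𝓝 0) := by
    have hexit : ∀ᵐ Y ∂P, ∀ L : ℕ, ∃ n, Y ∉ staySet (Set.Ioo (k - L) k) n :=
      ae_all_iff.2 fun L => ae_exists_notMem_staySet_Ioo hω hP _ _
    have hGm : Measurable G := (hDm.const_mul _).const_add _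
    filter_upwards [hbound, hexit, ae_lt_top hGm hGfin] with Y hb he hf
    obtain ⟨n, hn⟩ : ∃ n, Y ∉ staySet (Set.Iio k) n := by
      by_contra! hc
      obtain ⟨L, hL⟩ := exists_nat_gt (G Y).toReal
      obtain ⟨n, hn⟩ := he L
      refine hn fun j hj => ⟨?_, hc j j le_rfl⟩
      have hj := hb j
      simp only [hW, Set.indicator_of_mem (hc j)] at hj
      have := (ENNReal.ofReal_le_iff_le_toReal hf.ne).1 hj
      have h2 : (k : ℝ) - Y j < L := this.trans_lt hL
      have h3 : k - Y j < L := by exact_mod_cast h2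
      omega
    refine tendsto_const_nhds.congr' ?_
    filter_upwards [eventually_ge_atTop n] with m hm
    exact (Set.indicator_of_notMem
      (fun h : Y ∈ staySet (Set.Iio k) m => hn fun j hj => h j (hj.trans hm)) _).symm
  have hW0 : Tendsto (fun n => ∫⁻ Y, W n Y ∂P) atTop (𝓝 0) := by
    have := tendsto_lintegral_of_dominated_convergence G hWm (fun n => by
      filter_upwards [hbound] with Y hY using hY n) hGfin hlim
    simpa using this
  have hlim2 := (ENNReal.tendsto_nat_tsum fun n => ∫⁻ Y, C n Y ∂P).add hW0
  rw [add_zero, ← hDint] at hlim2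
  exact tendsto_nhds_unique hlim2 (tendsto_const_nhds.congr fun n => (hsum n).symm)

end
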